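/- arXiv:1112.2227 — 4 statements merged into one kernel-verified Lean document; each statement's English description precedes it below -/
import Mathlib

section
/- Let Φ be a stationary point process on ℝ^d of intensity λ that is ν-weakly sub-Poisson. Then the critical radius for percolation of the Boolean model satisfies r_c(Φ) ≤ √d · ( log(3^d − 2) / λ )^{1/d} < ∞. -/
open MeasureTheory ENNReal Metric

noncomputable section

/-- A subset of `ℝ^d` percolates if it contains an unbounded connected subset. -/
def Percolates {d : ℕ} (S : Set (EuclideanSpace ℝ (Fin d))) : Prop :=
  ∃ C : Set (EuclideanSpace ℝ (Fin d)), C ⊆ S ∧ IsConnected C ∧ ¬ Bornology.IsBounded C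

/-- The set of atoms (points) of a counting measure. -/
def atomsOf {d : ℕ} (μ : Measure (EuclideanSpace ℝ (Fin d))) :
    Set (EuclideanSpace ℝ (Fin d)) :=
  {x | μ {x} ≠ 0}

/-- The Boolean model `C(Φ,r) = ⋃_{X ∈ Φ} B_r(X)` of a counting measure. -/
def BooleanModel {d : ℕ} (μ : Measure (EuclideanSpace ℝ (Fin d))) (r : ℝ) :
    Set (EuclideanSpace ℝ (Fin d)) :=
  ⋃ x ∈ atomsOf μ, closedBall x r

/-- The critical radius for percolation of the Boolean model,
`r_c(Φ) = inf { r : P(C(Φ,r) percolates) > 0 }`. -/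
def criticalRadius {d : ℕ} {Ω : Type*} [MeasurableSpace Ω] (P : Measure Ω)
    (Φ : Ω → Measure (EuclideanSpace ℝ (Fin d))) : ℝ :=
  sInf {r : ℝ | 0 < P {ω | Percolates (BooleanModel (Φ ω) r)}}

/-- The triangular lattice structure on the quadrant `ℕ × ℕ`: nearest neighbours together with
the north-east diagonals. -/
def quadrantGraph : SimpleGraph (ℕ × ℕ) where
  Adj u v :=
    (v = (u.1 + 1, u.2) ∨ v = (u.1, u.2 + 1) ∨ v = (u.1 + 1, u.2 + 1)) ∨
    (u = (v.1 + 1, v.2) ∨ u = (v.1, v.2 + 1) ∨ u = (v.1 + 1, v.2 + 1))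
  symm := ⟨fun _ _ h => h.symm⟩
  loopless := ⟨fun ⟨x, y⟩ h => by simp at h⟩

/-- A finite set of sites containing every possible neighbour of `v` in `quadrantGraph`. -/
def quadrantNeighbors (v : ℕ × ℕ) : Finset (ℕ × ℕ) :=
  {(v.1 + 1, v.2), (v.1, v.2 + 1), (v.1 + 1, v.2 + 1),
    (v.1 - 1, v.2), (v.1, v.2 - 1), (v.1 - 1, v.2 - 1)}

theorem card_quadrantNeighbors_le (v : ℕ × ℕ) : (quadrantNeighbors v).card ≤ 6 :=
  Finset.card_le_six

theorem mem_quadrantNeighbors {u v : ℕ × ℕ} (h : quadrantGraph.Adj u v) :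
    v ∈ quadrantNeighbors u := by
  obtain ⟨a, b⟩ := u
  obtain ⟨c, e⟩ := v
  simp only [quadrantGraph, quadrantNeighbors, Prod.mk.injEq, Finset.mem_insert,
    Finset.mem_singleton] at h ⊢
  omega

theorem quadrantGraph_adj_bounds {u v : ℕ × ℕ} (h : quadrantGraph.Adj u v) :
    u.1 ≤ v.1 + 1 ∧ v.1 ≤ u.1 + 1 ∧ u.2 ≤ v.2 + 1 ∧ v.2 ≤ u.2 + 1 := by
  obtain ⟨a, b⟩ := u
  obtain ⟨c, e⟩ := v
  simp only [quadrantGraph, Prod.mk.injEq] at h ⊢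
  omega

theorem fst_le_fst_add_length {u v : ℕ × ℕ} (w : quadrantGraph.Walk u v) :
    u.1 ≤ v.1 + w.length := by
  induction w with
  | nil => simp
  | cons h p ih =>
    have := (quadrantGraph_adj_bounds h).1
    rw [SimpleGraph.Walk.length_cons]
    omega

open Classical in
theorem signedCrossing_triangle {a b c x y z : Prop} (hxa : x → ¬a) (hyb : y → ¬b)
    (hzc : z → ¬c) (h1 : a → y → ¬c → z) (h2 : a → z → ¬b → y) (h3 : b → x → ¬c → z)
    (h4 : b → z → ¬a → x) (h5 : c → x → ¬b → y) (h6 : c → y → ¬a → x) :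
    ((if a ∧ y then 1 else if x ∧ b then -1 else 0) +
      (if b ∧ z then 1 else if y ∧ c then -1 else 0) : ℤ) =
      if a ∧ z then 1 else if x ∧ c then -1 else 0 := by
  by_cases a <;> by_cases b <;> by_cases c <;> by_cases x <;> by_cases y <;> by_cases z <;>
    simp_all

open Classical in
theorem signedCrossing_eq_sub {a b x y : Prop} (hxa : x → ¬a) (hyb : y → ¬b)
    (h1 : a → ¬b → y) (h2 : b → ¬a → x) :
    (if a ∧ y then 1 else if x ∧ b then -1 else 0 : ℤ) =
      (if b then 0 else 1) - (if a then 0 else 1) := by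
  by_cases a <;> by_cases b <;> by_cases x <;> by_cases y <;> simp_all

/-- The outer boundary of a finite set of sites containing the corner of the quadrant contains a
walk joining the two sides of the quadrant. -/
theorem exists_boundary_walk {A : Set (ℕ × ℕ)} (hA : A.Finite) (h0 : (0, 0) ∈ A) :
    ∃ (m j : ℕ) (w : quadrantGraph.Walk (m, 0) (0, j)),
      ∀ v ∈ w.support, v ∉ A ∧ ∃ a ∈ A, quadrantGraph.Adj a v := by
  classical
  by_contra hcon
  push Not at hcon
  set K : Set (ℕ × ℕ) := {v | ∃ (m : ℕ) (w : quadrantGraph.Walk (m, 0) v),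
    ∀ u ∈ w.support, u ∉ A ∧ ∃ a ∈ A, quadrantGraph.Adj a u} with hK
  have hKA : ∀ v ∈ K, v ∉ A := fun v ⟨m, w, hw⟩ => (hw v w.end_mem_support).1
  have hK0 : ∀ j, (0, j) ∉ K := by
    rintro j ⟨m, w, hw⟩
    obtain ⟨v, hv, hv'⟩ := hcon m j w
    obtain ⟨h1, a, ha, h2⟩ := hw v hv
    exact hv' h1 a ha h2
  have hext : ∀ a v w, a ∈ A → v ∈ K → w ∉ A → quadrantGraph.Adj a w →
      quadrantGraph.Adj v w → w ∈ K := by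
    rintro a v w ha ⟨m, p, hp⟩ hw haw hvw
    refine ⟨m, p.concat hvw, fun u hu => ?_⟩
    rw [SimpleGraph.Walk.support_concat, List.mem_append,
      List.mem_singleton] at hu
    rcases hu with hu | rfl
    · exact hp u hu
    · exact ⟨hw, a, ha, haw⟩
  have hbase : ∀ a m, a ∈ A → (m, 0) ∉ A → quadrantGraph.Adj a (m, 0) → (m, 0) ∈ K := by
    intro a m ha hm h
    refine ⟨m, .nil, fun u hu => ?_⟩
    rw [SimpleGraph.Walk.support_nil, List.mem_singleton] at hu
    subst hu
    exact ⟨hm, a, ha, h⟩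
  set f : ℕ × ℕ → ℕ × ℕ → ℤ := fun u v =>
    if u ∈ A ∧ v ∈ K then 1 else if u ∈ K ∧ v ∈ A then -1 else 0 with hf
  have htri : ∀ u v w, quadrantGraph.Adj u v → quadrantGraph.Adj v w → quadrantGraph.Adj u w →
      f u v + f v w = f u w := by
    intro u v w huv hvw huw
    exact signedCrossing_triangle (hKA u) (hKA v) (hKA w)
      (fun a b c => hext u v w a b c huw hvw) (fun a b c => hext u w v a b c huv hvw.symm)
      (fun a b c => hext v u w a b c hvw huw) (fun a b c => hext v w u a b c huv.symm huw.symm)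
      (fun a b c => hext w u v a b c hvw.symm huv)
      (fun a b c => hext w v u a b c huw.symm huv.symm)
  obtain ⟨N, hN⟩ : ∃ N, ∀ v ∈ A, v.1 < N ∧ v.2 < N := by
    obtain ⟨B, hB⟩ := hA.bddAbove
    refine ⟨B.1 + B.2 + 1, fun v hv => ?_⟩
    have := hB hv
    have h1 := this.1
    have h2 := this.2
    omega
  set H : ℕ → ℤ := fun y => ∑ x ∈ Finset.range N, f (x, y) (x + 1, y) with hH
  have hstep : ∀ y, H (y + 1) = H y := by
    intro y
    have key : ∀ x, f (x, y + 1) (x + 1, y + 1) - f (x, y) (x + 1, y)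
        = f (x + 1, y) (x + 1, y + 1) - f (x, y) (x, y + 1) := by
      intro x
      have t1 := htri (x, y) (x + 1, y) (x + 1, y + 1) (by simp [quadrantGraph])
        (by simp [quadrantGraph]) (by simp [quadrantGraph])
      have t2 := htri (x, y) (x, y + 1) (x + 1, y + 1) (by simp [quadrantGraph])
        (by simp [quadrantGraph]) (by simp [quadrantGraph])
      linarith
    have hsum : H (y + 1) - H y = f (N, y) (N, y + 1) - f (0, y) (0, y + 1) := by
      simp only [hH]
      rw [← Finset.sum_sub_distrib, Finset.sum_congr rfl fun x _ => key x]
      exact Finset.sum_range_sub (fun x => f (x, y) (x, y + 1)) N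
    have n1 : ∀ z, (N, z) ∉ A := fun z hz => lt_irrefl _ (hN _ hz).1
    have : f (N, y) (N, y + 1) = 0 := by simp [hf, n1]
    have : f (0, y) (0, y + 1) = 0 := by simp [hf, hK0]
    linarith
  have hHconst : ∀ y, H y = H 0 := fun y => by
    induction y with
    | zero => rfl
    | succ y ih => rw [hstep, ih]
  have hHN : H N = 0 := by
    have n1 : ∀ z, (z, N) ∉ A := fun z hz => lt_irrefl _ (hN _ hz).2
    simp [hH, hf, n1]
  have hH0 : H 0 = 1 := by
    have key : ∀ x, f (x, 0) (x + 1, 0)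
        = (if (x + 1, 0) ∈ A then (0 : ℤ) else 1) - (if (x, 0) ∈ A then (0 : ℤ) else 1) := by
      intro x
      have h : quadrantGraph.Adj (x, 0) (x + 1, 0) := by simp [quadrantGraph]
      exact signedCrossing_eq_sub (hKA _) (hKA _) (fun a b => hbase _ _ a b h)
        (fun a b => hbase _ _ a b h.symm)
    simp only [hH]
    rw [Finset.sum_congr rfl fun x _ => key x,
      Finset.sum_range_sub (fun x => if (x, 0) ∈ A then (0 : ℤ) else 1) N]
    have n1 : (N, 0) ∉ A := fun hz => lt_irrefl _ (hN _ hz).1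
    simp [n1, h0]
  have := hHconst N
  omega

/-- `HasClosedPath c n F v` says that the sites of `F` lie in `c` and that there is a path of `n`
steps in `c` starting from `v` whose new sites are distinct and avoid `F`. -/
def HasClosedPath (c : Set (ℕ × ℕ)) : ℕ → Finset (ℕ × ℕ) → ℕ × ℕ → Prop
  | 0, F, _ => (F : Set (ℕ × ℕ)) ⊆ c
  | n + 1, F, v => ∃ u ∈ quadrantNeighbors v, u ∉ F ∧ HasClosedPath c n (insert u F) u

theorem SimpleGraph.Walk.IsPath.hasClosedPath {c : Set (ℕ × ℕ)} {v z : ℕ × ℕ}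
    {w : quadrantGraph.Walk v z} (hw : w.IsPath) (hc : ∀ x ∈ w.support, x ∈ c) {n : ℕ}
    (hn : n ≤ w.length) {F : Finset (ℕ × ℕ)} (hF : (F : Set (ℕ × ℕ)) ⊆ c)
    (hdisj : ∀ x ∈ w.support, x ∈ F → x = v) : HasClosedPath c n F v := by
  induction w generalizing n F with
  | nil =>
    obtain rfl : n = 0 := by simpa using hn
    exact hF
  | @cons v u z h p ih =>
    cases n with
    | zero => exact hF
    | succ n =>
      rw [SimpleGraph.Walk.cons_isPath_iff] at hw
      simp only [SimpleGraph.Walk.support_cons, List.mem_cons, forall_eq_or_imp] at hc hdisj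
      refine ⟨u, mem_quadrantNeighbors h, fun hu => ?_, ih hw.1 hc.2 (by simpa using hn) ?_ ?_⟩
      · exact h.ne (hdisj.2 u p.start_mem_support hu).symm
      · rw [Finset.coe_insert, Set.insert_subset_iff]
        exact ⟨hc.2 u p.start_mem_support, hF⟩
      · intro x hx hxF
        rcases Finset.mem_insert.1 hxF with rfl | hxF
        · rfl
        · exact absurd (hdisj.2 x hx hxF ▸ hx) hw.2

theorem measure_hasClosedPath_le {Ω : Type*} [MeasurableSpace Ω] {P : Measure Ω}
    {Z : Ω → Set (ℕ × ℕ)} {p : ENNReal}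
    (hZ : ∀ F : Finset (ℕ × ℕ), P {ω | (F : Set (ℕ × ℕ)) ⊆ Z ω} ≤ p ^ F.card)
    (n : ℕ) (F : Finset (ℕ × ℕ)) (v : ℕ × ℕ) :
    P {ω | HasClosedPath (Z ω) n F v} ≤ 6 ^ n * p ^ (F.card + n) := by
  induction n generalizing F v with
  | zero => simpa [HasClosedPath] using hZ F
  | succ n ih =>
    calc P {ω | HasClosedPath (Z ω) (n + 1) F v}
        ≤ P (⋃ u ∈ quadrantNeighbors v,
            {ω | u ∉ F ∧ HasClosedPath (Z ω) n (insert u F) u}) := by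
          refine measure_mono fun ω hω => ?_
          simpa [HasClosedPath, and_left_comm] using hω
      _ ≤ ∑ u ∈ quadrantNeighbors v, P {ω | u ∉ F ∧ HasClosedPath (Z ω) n (insert u F) u} :=
          measure_biUnion_finset_le _ _
      _ ≤ ∑ _u ∈ quadrantNeighbors v, 6 ^ n * p ^ (F.card + (n + 1)) := by
          refine Finset.sum_le_sum fun u _ => ?_
          by_cases hu : u ∈ F
          · simp [hu]
          · refine le_trans (measure_mono fun ω hω => hω.2) ((ih (insert u F) u).trans_eq ?_)
            rw [Finset.card_insert_of_notMem hu]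
            congr 2
            omega
      _ ≤ 6 * (6 ^ n * p ^ (F.card + (n + 1))) := by
          rw [Finset.sum_const, nsmul_eq_mul]
          gcongr
          exact_mod_cast card_quadrantNeighbors_le v
      _ = 6 ^ (n + 1) * p ^ (F.card + (n + 1)) := by rw [pow_succ' (6 : ENNReal) n, mul_assoc]

/-- The cluster of `u` in the subgraph of `quadrantGraph` induced by the complement of `c`. -/
def openCluster (c : Set (ℕ × ℕ)) (u : ℕ × ℕ) : Set (ℕ × ℕ) :=
  {v | Relation.ReflTransGen (fun a b => quadrantGraph.Adj a b ∧ a ∉ c ∧ b ∉ c) u v}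

theorem exists_hasClosedPath_of_finite_openCluster {c : Set (ℕ × ℕ)}
    (hfin : ∀ u ∉ c, (openCluster c u).Finite) (k : ℕ) :
    ∃ m ≥ k, HasClosedPath c m {(m, 0)} (m, 0) := by
  classical
  set S : Set (ℕ × ℕ) := Set.Iic (k, 0) with hS
  set N : Set (ℕ × ℕ) := Set.Iic (k + 1, 1) with hN
  set A : Set (ℕ × ℕ) := S ∪ ⋃ u ∈ N ∩ cᶜ, openCluster c u with hAdef
  have hAfin : A.Finite :=
    (Set.finite_Iic _).union <|
      ((Set.finite_Iic _).inter_of_left _).biUnion fun u hu => hfin u hu.2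
  obtain ⟨m, j, w, hw⟩ := exists_boundary_walk hAfin (Or.inl (by simp [hS]))
  have hclosed : ∀ v ∈ w.support, v ∈ c := by
    intro v hv
    obtain ⟨hvA, a, ha, hav⟩ := hw v hv
    by_contra hvc
    apply hvA
    refine Or.inr ?_
    simp only [Set.mem_iUnion]
    rcases ha with ha | ha
    · refine ⟨v, ⟨?_, hvc⟩, Relation.ReflTransGen.refl⟩
      have h := quadrantGraph_adj_bounds hav
      have h1 : a.1 ≤ k := ha.1
      have h2 : a.2 ≤ 0 := ha.2
      exact ⟨show v.1 ≤ k + 1 by omega, show v.2 ≤ 1 by omega⟩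
    · simp only [Set.mem_iUnion] at ha
      obtain ⟨u, hu, hua⟩ := ha
      refine ⟨u, hu, Relation.ReflTransGen.tail hua ⟨hav, ?_, hvc⟩⟩
      rcases Relation.ReflTransGen.cases_tail hua with rfl | ⟨b, _, hb⟩
      · exact hu.2
      · exact hb.2.2
  have hm : k ≤ m := by
    by_contra hlt
    refine (hw _ w.start_mem_support).1 (Or.inl ?_)
    exact ⟨show m ≤ k by omega, le_rfl⟩
  refine ⟨m, hm, w.bypass_isPath.hasClosedPath
    (fun x hx => hclosed x (w.support_bypass_subset_support hx)) ?_ ?_ ?_⟩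
  · simpa using fst_le_fst_add_length w.bypass
  · simpa using hclosed _ w.start_mem_support
  · intro x _ hx
    exact Finset.mem_singleton.1 hx

theorem ae_exists_infinite_openCluster {Ω : Type*} [MeasurableSpace Ω] {P : Measure Ω}
    {Z : Ω → Set (ℕ × ℕ)} {p : ENNReal} (hp : 6 * p < 1)
    (hZ : ∀ F : Finset (ℕ × ℕ), P {ω | (F : Set (ℕ × ℕ)) ⊆ Z ω} ≤ p ^ F.card) :
    ∀ᵐ ω ∂P, ∃ u ∉ Z ω, (openCluster (Z ω) u).Infinite := by
  have hp1 : p ≤ 1 := by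
    refine le_trans ?_ hp.le
    exact le_mul_of_one_le_left' (by norm_num)
  have hsum : ∑' m : ℕ, P {ω | HasClosedPath (Z ω) m {(m, 0)} (m, 0)} ≠ ⊤ := by
    refine ne_top_of_le_ne_top (b := ∑' m : ℕ, (6 * p) ^ m) ?_ (ENNReal.tsum_le_tsum fun m => ?_)
    · rw [ENNReal.tsum_geometric]
      exact ENNReal.inv_ne_top.2 (tsub_pos_of_lt hp).ne'
    · refine (measure_hasClosedPath_le hZ m _ _).trans ?_
      rw [mul_pow]
      gcongr 6 ^ m * ?_
      exact pow_le_pow_right_of_le_one' hp1 (by omega)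
  filter_upwards [ae_eventually_notMem hsum] with ω hω
  obtain ⟨k, hk⟩ := Filter.eventually_atTop.1 hω
  by_contra hcon
  push Not at hcon
  obtain ⟨m, hm, h⟩ := exists_hasClosedPath_of_finite_openCluster
    (fun u hu => by simpa using hcon u hu) k
  exact hk m hm h

/-- The lower corner, in units of the side length, of the cube indexed by `v`. -/
def cubeCorner {d : ℕ} (v : ℕ × ℕ) (l : Fin d) : ℕ :=
  if l.val = 0 then v.1 else if l.val = 1 then v.2 else 0

/-- The half-open cubes of side `s` in `ℝ^d` that tile a quadrant of a two-dimensional slab. -/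
def slabCube (d : ℕ) (s : ℝ) (v : ℕ × ℕ) : Set (EuclideanSpace ℝ (Fin d)) :=
  WithLp.ofLp ⁻¹' (Set.univ.pi fun l =>
    Set.Ico (s * (cubeCorner v l : ℝ)) (s * (cubeCorner v l : ℝ) + s))

theorem mem_slabCube {d : ℕ} {s : ℝ} {v : ℕ × ℕ} {x : EuclideanSpace ℝ (Fin d)} :
    x ∈ slabCube d s v ↔
      ∀ l, s * (cubeCorner v l : ℝ) ≤ x l ∧ x l < s * (cubeCorner v l : ℝ) + s := by
  simp [slabCube]

theorem measurableSet_slabCube (d : ℕ) (s : ℝ) (v : ℕ × ℕ) : MeasurableSet (slabCube d s v) :=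
  (PiLp.volume_preserving_ofLp (Fin d)).measurable
    (MeasurableSet.univ_pi fun _ => measurableSet_Ico)

theorem volume_slabCube {d : ℕ} (s : ℝ) (v : ℕ × ℕ) :
    volume (slabCube d s v) = ENNReal.ofReal s ^ d := by
  rw [slabCube, (PiLp.volume_preserving_ofLp (Fin d)).measure_preimage
    (MeasurableSet.univ_pi fun _ => measurableSet_Ico).nullMeasurableSet, Real.volume_pi_Ico]
  simp

theorem dist_le_of_mem_slabCube {d : ℕ} {s t : ℝ} (hs : 0 ≤ s) (ht : 0 ≤ t) {u v : ℕ × ℕ}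
    (h : ∀ l : Fin d, |(cubeCorner u l : ℝ) - cubeCorner v l| ≤ t)
    {x y : EuclideanSpace ℝ (Fin d)}
    (hx : x ∈ slabCube d s u) (hy : y ∈ slabCube d s v) :
    dist x y ≤ √d * ((t + 1) * s) := by
  rw [mem_slabCube] at hx hy
  have hl : ∀ l, dist (x l) (y l) ^ 2 ≤ ((t + 1) * s) ^ 2 := by
    intro l
    have h1 := abs_le.1 (h l)
    have := hx l
    have := hy l
    have h3 := mul_le_mul_of_nonneg_left h1.1 hs
    have h4 := mul_le_mul_of_nonneg_left h1.2 hs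
    refine pow_le_pow_left₀ dist_nonneg ?_ 2
    rw [Real.dist_eq, abs_le]
    constructor <;> nlinarith
  rw [EuclideanSpace.dist_eq]
  refine Real.sqrt_le_iff.2 ⟨by positivity, (Finset.sum_le_sum fun l _ => hl l).trans_eq ?_⟩
  rw [mul_pow √(d : ℝ), Real.sq_sqrt (Nat.cast_nonneg d)]
  simp

theorem abs_cubeCorner_sub_le {d : ℕ} {u v : ℕ × ℕ} (h : quadrantGraph.Adj u v) (l : Fin d) :
    |(cubeCorner u l : ℝ) - cubeCorner v l| ≤ 1 := by
  have hb := quadrantGraph_adj_bounds h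
  have h1 : cubeCorner u l ≤ cubeCorner v l + 1 ∧ cubeCorner v l ≤ cubeCorner u l + 1 := by
    unfold cubeCorner
    split_ifs <;> omega
  have h2 : (cubeCorner u l : ℝ) ≤ cubeCorner v l + 1 := by exact_mod_cast h1.1
  have h3 : (cubeCorner v l : ℝ) ≤ cubeCorner u l + 1 := by exact_mod_cast h1.2
  rw [abs_le]
  constructor <;> linarith

theorem isBounded_slabCube {d : ℕ} {s : ℝ} (hs : 0 ≤ s) (v : ℕ × ℕ) :
    Bornology.IsBounded (slabCube d s v) :=
  isBounded_iff.2 ⟨_, fun _ hx _ hy =>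
    dist_le_of_mem_slabCube hs le_rfl (fun l => by simp) hx hy⟩

theorem disjoint_slabCube {d : ℕ} (hd : 2 ≤ d) {s : ℝ} (hs : 0 < s) {u v : ℕ × ℕ}
    (huv : u ≠ v) : Disjoint (slabCube d s u) (slabCube d s v) := by
  have hcoord : ∀ {a b : ℕ} {t : ℝ}, s * a ≤ t ∧ t < s * a + s → s * b ≤ t ∧ t < s * b + s →
      a ≤ b := by
    intro a b t h1 h2
    have : s * (a : ℝ) < s * (b + 1) := by linarith [h1.1, h2.2]
    have : (a : ℝ) < b + 1 := lt_of_mul_lt_mul_left this hs.le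
    have : a < b + 1 := by exact_mod_cast this
    omega
  refine Set.disjoint_left.2 fun x hx hy => huv ?_
  rw [mem_slabCube] at hx hy
  have x0 := hx ⟨0, by omega⟩
  have y0 := hy ⟨0, by omega⟩
  have x1 := hx ⟨1, by omega⟩
  have y1 := hy ⟨1, by omega⟩
  simp only [cubeCorner, if_true, one_ne_zero, if_false] at x0 y0 x1 y1
  exact Prod.ext (le_antisymm (hcoord x0 y0) (hcoord y0 x0))
    (le_antisymm (hcoord x1 y1) (hcoord y1 x1))

/-- A measure taking natural number values on bounded measurable sets has an atom in every
bounded measurable set which it charges. -/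
theorem exists_mem_atomsOf {d : ℕ} {μ : Measure (EuclideanSpace ℝ (Fin d))}
    (hμ : ∀ B : Set (EuclideanSpace ℝ (Fin d)),
      MeasurableSet B → Bornology.IsBounded B → ∃ n : ℕ, μ B = n)
    {B : Set (EuclideanSpace ℝ (Fin d))} (hB : μ B ≠ 0) :
    ∃ x ∈ B, x ∈ atomsOf μ := by
  by_contra! hcon
  refine hB (measure_null_of_locally_null B fun x hx => ?_)
  have hx0 : μ {x} = 0 := by simpa [atomsOf] using hcon x hx
  obtain ⟨n, hn⟩ := hμ (ball x 1) measurableSet_ball isBounded_ball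
  have : IsFiniteMeasure (μ.restrict (ball x 1)) :=
    ⟨by rw [Measure.restrict_apply_univ, hn]; exact ENNReal.natCast_lt_top n⟩
  obtain ⟨U, hxU, hUo, hU⟩ := Set.exists_isOpen_lt_of_lt (μ := μ.restrict (ball x 1)) {x} 1
    ((Measure.restrict_apply_le _ _).trans_lt (by simp [hx0]))
  refine ⟨U ∩ ball x 1, mem_nhdsWithin_of_mem_nhds (Filter.inter_mem
    (hUo.mem_nhds (hxU rfl)) (ball_mem_nhds x one_pos)), ?_⟩
  rw [Measure.restrict_apply hUo.measurableSet] at hU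
  obtain ⟨k, hk⟩ := hμ (U ∩ ball x 1) (hUo.measurableSet.inter measurableSet_ball)
    (isBounded_ball.subset Set.inter_subset_right)
  rw [hk] at hU ⊢
  have : k < 1 := by exact_mod_cast hU
  simpa using this

theorem percolates_of_infinite_openCluster {d : ℕ} (hd : 2 ≤ d) {s : ℝ} (hs : 0 < s)
    {μ : Measure (EuclideanSpace ℝ (Fin d))}
    (hμ : ∀ B : Set (EuclideanSpace ℝ (Fin d)),
      MeasurableSet B → Bornology.IsBounded B → ∃ n : ℕ, μ B = n)
    {u : ℕ × ℕ} (hu : μ (slabCube d s u) ≠ 0)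
    (hinf : (openCluster {v | μ (slabCube d s v) = 0} u).Infinite) :
    Percolates (BooleanModel μ (√d * s)) := by
  set c : Set (ℕ × ℕ) := {v | μ (slabCube d s v) = 0} with hc
  have hopen : ∀ v ∈ openCluster c u, v ∉ c := by
    intro v hv
    rcases Relation.ReflTransGen.cases_tail hv with rfl | ⟨b, _, hb⟩
    · exact hu
    · exact hb.2.2
  have hpt : ∀ v, ∃ x, v ∉ c → x ∈ slabCube d s v ∧ x ∈ atomsOf μ := by
    intro v
    by_cases hv : v ∈ c
    · exact ⟨0, fun h => absurd hv h⟩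
    · obtain ⟨x, hx⟩ := exists_mem_atomsOf hμ hv
      exact ⟨x, fun _ => hx⟩
  choose X hX using hpt
  have hr : 0 ≤ √d * s := by positivity
  refine ⟨⋃ v ∈ openCluster c u, closedBall (X v) (√d * s), ?_, ?_, fun hbdd => hinf ?_⟩
  · exact Set.iUnion₂_subset fun v hv =>
      Set.subset_biUnion_of_mem (u := fun x => closedBall x (√d * s)) (hX v (hopen v hv)).2
  · refine IsConnected.biUnion_of_reflTransGen ⟨u, Relation.ReflTransGen.refl⟩
      (fun v _ => ((convex_closedBall _ _).isConnected ⟨X v, mem_closedBall_self hr⟩)) ?_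
    have hmeet : ∀ a b, quadrantGraph.Adj a b → a ∉ c → b ∉ c →
        (closedBall (X a) (√d * s) ∩ closedBall (X b) (√d * s)).Nonempty := by
      intro a b hab ha hb
      have hdist := dist_le_of_mem_slabCube hs.le zero_le_one (abs_cubeCorner_sub_le hab)
        (hX a ha).1 (hX b hb).1
      refine ⟨midpoint ℝ (X a) (X b), ?_, ?_⟩
      · rw [mem_closedBall, dist_midpoint_left, Real.norm_ofNat]
        linarith
      · rw [mem_closedBall, dist_midpoint_right, Real.norm_ofNat]
        linarith
    set R : ℕ × ℕ → ℕ × ℕ → Prop := fun i j =>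
      (closedBall (X i) (√d * s) ∩ closedBall (X j) (√d * s)).Nonempty ∧ i ∈ openCluster c u
    have hfrom : ∀ v ∈ openCluster c u,
        Relation.ReflTransGen R u v ∧ Relation.ReflTransGen R v u := by
      intro v hv
      induction hv with
      | refl => exact ⟨.refl, .refl⟩
      | @tail a b hua hab ih =>
        have h := hmeet a b hab.1 hab.2.1 hab.2.2
        exact ⟨ih.1.tail ⟨h, hua⟩,
          .head ⟨Set.inter_comm _ _ ▸ h, Relation.ReflTransGen.tail hua hab⟩ ih.2⟩
    exact fun i hi j hj => (hfrom i hi).2.trans (hfrom j hj).1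
  · obtain ⟨M, hM⟩ := hbdd.exists_norm_le
    have hle : ∀ {a : ℕ} {t : ℝ}, s * a ≤ t → |t| ≤ M → a ≤ ⌊M / s⌋₊ := by
      intro a t h1 h2
      refine Nat.le_floor ((le_div_iff₀ hs).2 ?_)
      linarith [le_abs_self t]
    refine (Set.finite_Iic ((⌊M / s⌋₊, ⌊M / s⌋₊) : ℕ × ℕ)).subset fun v hv => ?_
    have hn : ∀ l, |X v l| ≤ M := fun l =>
      (PiLp.norm_apply_le (X v) l).trans
        (hM _ (Set.mem_biUnion hv (mem_closedBall_self hr)))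
    have hx := mem_slabCube.1 (hX v (hopen v hv)).1
    have x0 := (hx ⟨0, by omega⟩).1
    have x1 := (hx ⟨1, by omega⟩).1
    simp only [cubeCorner, if_true, one_ne_zero, if_false] at x0 x1
    exact ⟨hle x0 (hn _), hle x1 (hn _)⟩

theorem Percolates.radius_nonneg {d : ℕ} {μ : Measure (EuclideanSpace ℝ (Fin d))} {r : ℝ}
    (h : Percolates (BooleanModel μ r)) : 0 ≤ r := by
  obtain ⟨C, hC, hconn, -⟩ := h
  obtain ⟨x, hx⟩ := hconn.nonempty
  obtain ⟨y, -, hy⟩ := Set.mem_iUnion₂.1 (hC hx)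
  exact dist_nonneg.trans (mem_closedBall.1 hy)

theorem measure_void_slabCubes_le {d : ℕ} (hd : 2 ≤ d) {Ω : Type*} [MeasurableSpace Ω]
    {P : Measure Ω} {Φ : Ω → Measure (EuclideanSpace ℝ (Fin d))} {lam : ℝ} (hlam : 0 < lam)
    (hint : ∀ B : Set (EuclideanSpace ℝ (Fin d)), MeasurableSet B →
      ∫⁻ ω, Φ ω B ∂P = ENNReal.ofReal lam * volume B)
    (hnu : ∀ B : Set (EuclideanSpace ℝ (Fin d)), MeasurableSet B → Bornology.IsBounded B →
      P {ω | Φ ω B = 0} ≤ ENNReal.ofReal (Real.exp (-(∫⁻ ω, Φ ω B ∂P).toReal)))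
    {s : ℝ} (hs : 0 < s) (F : Finset (ℕ × ℕ)) :
    P {ω | (F : Set (ℕ × ℕ)) ⊆ {v | Φ ω (slabCube d s v) = 0}} ≤
      ENNReal.ofReal (Real.exp (-(lam * s ^ d))) ^ F.card := by
  have hmeas : MeasurableSet (⋃ v ∈ F, slabCube d s v) :=
    F.measurableSet_biUnion fun v _ => measurableSet_slabCube d s v
  have hbdd : Bornology.IsBounded (⋃ v ∈ F, slabCube d s v) :=
    (Bornology.isBounded_biUnion_finset F).2 fun v _ => isBounded_slabCube hs.le v
  have hvol : volume (⋃ v ∈ F, slabCube d s v) = F.card * ENNReal.ofReal s ^ d := by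
    rw [measure_biUnion_finset (fun u _ v _ huv => disjoint_slabCube hd hs huv)
      fun v _ => measurableSet_slabCube d s v]
    simp [volume_slabCube]
  calc P {ω | (F : Set (ℕ × ℕ)) ⊆ {v | Φ ω (slabCube d s v) = 0}}
      ≤ P {ω | Φ ω (⋃ v ∈ F, slabCube d s v) = 0} := by
        refine measure_mono fun ω hω => ?_
        exact (measure_biUnion_null_iff F.countable_toSet).2 fun v hv => hω hv
    _ ≤ _ := hnu _ hmeas hbdd
    _ = ENNReal.ofReal (Real.exp (-(lam * s ^ d))) ^ F.card := by
        rw [hint _ hmeas, hvol, ← ENNReal.ofReal_pow (Real.exp_nonneg _), ← Real.exp_nat_mul]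
        simp only [ENNReal.toReal_mul, ENNReal.toReal_pow, ENNReal.toReal_natCast,
          ENNReal.toReal_ofReal hlam.le, ENNReal.toReal_ofReal hs.le]
        congr 2
        ring

theorem exp_neg_lt_of_radius_lt {d : ℕ} (hd : 2 ≤ d) {lam : ℝ} (hlam : 0 < lam) {s : ℝ}
    (h : √d * (Real.log ((3 : ℝ) ^ d - 2) / lam) ^ ((1 : ℝ) / d) < √d * s) :
    6 * Real.exp (-(lam * s ^ d)) < 1 := by
  have h9 : (9 : ℝ) ≤ 3 ^ d := by
    calc (9 : ℝ) = 3 ^ 2 := by norm_num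
      _ ≤ 3 ^ d := pow_le_pow_right₀ (by norm_num) hd
  have hlog : 0 ≤ Real.log ((3 : ℝ) ^ d - 2) / lam :=
    div_nonneg (Real.log_nonneg (by linarith)) hlam.le
  have h1 := pow_lt_pow_left₀ (lt_of_mul_lt_mul_left h (Real.sqrt_nonneg d))
    (Real.rpow_nonneg hlog _) (show d ≠ 0 by omega)
  rw [one_div, Real.rpow_inv_natCast_pow hlog (by omega), div_lt_iff₀ hlam, mul_comm] at h1
  have h2 : (3 : ℝ) ^ d - 2 < Real.exp (lam * s ^ d) := by
    rwa [← Real.log_lt_iff_lt_exp (by linarith)]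
  rw [Real.exp_neg, ← div_eq_mul_inv, div_lt_one (Real.exp_pos _)]
  linarith

/-- for a stationary, ν-weakly sub-Poisson point process `Φ` on `ℝ^d`
(`d ≥ 2`) of intensity `λ`, the critical radius of the Boolean model satisfies
`r_c(Φ) ≤ √d (log(3^d − 2)/λ)^{1/d} < ∞`. -/
theorem critical_radius_le_of_nuWeaklySubPoisson
    {d : ℕ} (hd : 2 ≤ d)
    {Ω : Type*} [MeasurableSpace Ω] (P : Measure Ω) [IsProbabilityMeasure P]
    (Φ : Ω → Measure (EuclideanSpace ℝ (Fin d)))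
    (hΦmeas : Measurable Φ)
    -- `Φ` is a point process: almost surely a Radon counting measure
    (hcount : ∀ᵐ ω ∂P, ∀ B : Set (EuclideanSpace ℝ (Fin d)),
      MeasurableSet B → Bornology.IsBounded B → ∃ n : ℕ, Φ ω B = n)
    -- `Φ` is stationary with intensity `lam`
    (lam : ℝ) (hlam : 0 < lam)
    (hstat : ∀ v : EuclideanSpace ℝ (Fin d),
      P.map (fun ω => (Φ ω).map (fun x => v + x)) = P.map Φ)
    (hint : ∀ B : Set (EuclideanSpace ℝ (Fin d)), MeasurableSet B →
      ∫⁻ ω, Φ ω B ∂P = ENNReal.ofReal lam * volume B)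
    -- `Φ` is ν-weakly sub-Poisson
    (hnu : ∀ B : Set (EuclideanSpace ℝ (Fin d)), MeasurableSet B → Bornology.IsBounded B →
      P {ω | Φ ω B = 0} ≤ ENNReal.ofReal (Real.exp (-(∫⁻ ω, Φ ω B ∂P).toReal))) :
    criticalRadius P Φ
      ≤ Real.sqrt d * (Real.log ((3 : ℝ) ^ d - 2) / lam) ^ ((1 : ℝ) / d) := by
  have hbdd : BddBelow {r : ℝ | 0 < P {ω | Percolates (BooleanModel (Φ ω) r)}} := by
    refine ⟨0, fun r hr => ?_⟩
    obtain ⟨ω, hω⟩ := nonempty_of_measure_ne_zero (ne_of_gt hr)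
    exact Percolates.radius_nonneg hω
  refine le_of_forall_gt_imp_ge_of_dense fun r hr => csInf_le hbdd ?_
  have hd0 : 0 < √(d : ℝ) := Real.sqrt_pos.2 (by exact_mod_cast (by omega : 0 < d))
  obtain ⟨s, rfl⟩ : ∃ s, r = √d * s := ⟨r / √d, by field_simp⟩
  have h9 : (9 : ℝ) ≤ 3 ^ d := by
    calc (9 : ℝ) = 3 ^ 2 := by norm_num
      _ ≤ 3 ^ d := pow_le_pow_right₀ (by norm_num) hd
  have hs : 0 < s := by
    refine lt_of_le_of_lt ?_ (lt_of_mul_lt_mul_left hr hd0.le)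
    exact Real.rpow_nonneg (div_nonneg (Real.log_nonneg (by linarith)) hlam.le) _
  have hp : 6 * ENNReal.ofReal (Real.exp (-(lam * s ^ d))) < 1 := by
    rw [← ENNReal.ofReal_ofNat 6, ← ENNReal.ofReal_mul (by norm_num), ENNReal.ofReal_lt_one]
    exact exp_neg_lt_of_radius_lt hd hlam hr
  have hae : ∀ᵐ ω ∂P, Percolates (BooleanModel (Φ ω) (√d * s)) := by
    filter_upwards [hcount, ae_exists_infinite_openCluster hp
      (measure_void_slabCubes_le hd hlam hint hnu hs)] with ω hω ⟨u, hu, hinf⟩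
    exact percolates_of_infinite_openCluster hd hs hω hu hinf
  exact pos_iff_ne_zero.2 (frequently_ae_iff.1 hae.frequently)
end
end

section
/- Let Φ be a simple, stationary, α-weakly sub-Poisson point process on ℝ^d of intensity λ. Then for every r > 0, every s > 0, every n ≥ 1 and all distinct sites z_1,…,z_n ∈ 2rℤ^d: P( Φ(Q_r(z_i)) ≥ 1 for all 1 ≤ i ≤ n ) ≤ ( exp{ −( s + (1 − e^s) λ (2r)^d ) } )^n, where Q_r(z) = z + (−r,r]^d. -/
open MeasureTheory ENNReal Metric

noncomputable section

/-- The cube `Q_r(z) = z + (−r,r]^d` in `ℝ^d`. -/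
def Qcube {d : ℕ} (r : ℝ) (z : EuclideanSpace ℝ (Fin d)) :
    Set (EuclideanSpace ℝ (Fin d)) :=
  {x | ∀ j : Fin d, z j - r < x j ∧ x j ≤ z j + r}

theorem Qcube_eq_preimage {d : ℕ} (r : ℝ) (z : EuclideanSpace ℝ (Fin d)) :
    Qcube r z = (WithLp.ofLp : EuclideanSpace ℝ (Fin d) → Fin d → ℝ) ⁻¹'
      Set.univ.pi (fun j => Set.Ioc (z j - r) (z j + r)) := by
  ext x
  simp [Qcube]

theorem measurableSet_Qcube {d : ℕ} (r : ℝ) (z : EuclideanSpace ℝ (Fin d)) :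
    MeasurableSet (Qcube r z) := by
  rw [Qcube_eq_preimage]
  exact (WithLp.measurable_ofLp 2 _) (MeasurableSet.univ_pi fun _ => measurableSet_Ioc)

theorem isBounded_Qcube {d : ℕ} (r : ℝ) (z : EuclideanSpace ℝ (Fin d)) :
    Bornology.IsBounded (Qcube r z) := by
  rw [Qcube_eq_preimage]
  exact (PiLp.antilipschitzWith_ofLp 2 fun _ : Fin d => ℝ).isBounded_preimage
    (Bornology.IsBounded.pi fun _ => isBounded_Ioc _ _)

theorem volume_Qcube {d : ℕ} (r : ℝ) (hr : 0 < r) (z : EuclideanSpace ℝ (Fin d)) :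
    volume (Qcube r z) = ENNReal.ofReal ((2 * r) ^ d) := by
  rw [Qcube_eq_preimage, (PiLp.volume_preserving_ofLp (Fin d)).measure_preimage
    (MeasurableSet.univ_pi fun _ => measurableSet_Ioc).nullMeasurableSet, Real.volume_pi_Ioc,
    ENNReal.ofReal_pow (by positivity)]
  have h : ∀ x : ℝ, x + r - (x - r) = 2 * r := fun x => by ring
  simp [h]

theorem disjoint_Qcube {d : ℕ} {r : ℝ} (hr : 0 < r) {z w : EuclideanSpace ℝ (Fin d)}
    (hz : ∃ m : Fin d → ℤ, ∀ j, z j = 2 * r * (m j))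
    (hw : ∃ m : Fin d → ℤ, ∀ j, w j = 2 * r * (m j)) (hzw : z ≠ w) :
    Disjoint (Qcube r z) (Qcube r w) := by
  obtain ⟨m, hm⟩ := hz
  obtain ⟨k, hk⟩ := hw
  rw [Set.disjoint_left]
  intro x hx hx'
  refine hzw (PiLp.ext fun j => ?_)
  have h1 := hx j
  have h2 := hx' j
  rw [hm j] at h1 ⊢
  rw [hk j] at h2 ⊢
  have h3 : (m j : ℝ) < k j + 1 := by
    by_contra! h
    nlinarith
  have h4 : (k j : ℝ) < m j + 1 := by
    by_contra! h
    nlinarith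
  have h5 : m j = k j := by
    norm_cast at h3 h4
    lia
  rw [h5]

theorem min_one_le_exp {a s : ℝ} (ha : 0 < a) (hs : 0 ≤ s) :
    min 1 a ≤ Real.exp (-(s + (1 - Real.exp s) * a)) := by
  rcases le_total 1 a with h | h
  · rw [min_eq_left h, Real.one_le_exp_iff]
    nlinarith [Real.add_one_le_exp s]
  · rw [min_eq_right h, ← Real.log_le_iff_le_exp ha]
    have h1 := Real.add_one_le_exp (s + Real.log a)
    rw [Real.exp_add, Real.exp_log ha] at h1
    linarith

/-- for a simple, stationary, α-weakly sub-Poisson point process `Φ`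
of intensity `λ` and distinct sites `z_1, …, z_n` of the scaled lattice `2rℤ^d`,
`P(Φ(Q_r(z_i)) ≥ 1 for all i) ≤ (exp{−(s + (1 − e^s) λ (2r)^d)})^n`. -/
theorem occupied_sites_bound_of_alphaWeaklySubPoisson
    {d : ℕ} {Ω : Type*} [MeasurableSpace Ω] (P : Measure Ω) [IsProbabilityMeasure P]
    (Φ : Ω → Measure (EuclideanSpace ℝ (Fin d)))
    (hΦmeas : Measurable Φ)
    -- `Φ` is a point process: almost surely a Radon counting measure
    (hcount : ∀ᵐ ω ∂P, ∀ B : Set (EuclideanSpace ℝ (Fin d)),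
      MeasurableSet B → Bornology.IsBounded B → ∃ n : ℕ, Φ ω B = n)
    -- `Φ` is simple
    (hsimple : ∀ᵐ ω ∂P, ∀ x, Φ ω {x} ≤ 1)
    -- `Φ` is stationary with intensity `lam`
    (lam : ℝ) (hlam : 0 < lam)
    (hstat : ∀ v : EuclideanSpace ℝ (Fin d),
      P.map (fun ω => (Φ ω).map (fun x => v + x)) = P.map Φ)
    (hint : ∀ B : Set (EuclideanSpace ℝ (Fin d)), MeasurableSet B →
      ∫⁻ ω, Φ ω B ∂P = ENNReal.ofReal lam * volume B)
    -- `Φ` is α-weakly sub-Poisson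
    (hsub : ∀ (k : ℕ) (B : Fin k → Set (EuclideanSpace ℝ (Fin d))),
      (∀ i, MeasurableSet (B i) ∧ Bornology.IsBounded (B i)) →
      Pairwise (Function.onFun Disjoint B) →
      ∫⁻ ω, ∏ i, Φ ω (B i) ∂P ≤ ∏ i, ∫⁻ ω, Φ ω (B i) ∂P)
    -- parameters and distinct sites of the lattice `2rℤ^d`
    (r s : ℝ) (hr : 0 < r) (hs : 0 < s)
    (n : ℕ) (hn : 1 ≤ n)
    (z : Fin n → EuclideanSpace ℝ (Fin d))
    (hlattice : ∀ i, ∃ m : Fin d → ℤ, ∀ j, z i j = 2 * r * (m j))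
    (hdistinct : Function.Injective z) :
    P {ω | ∀ i, 1 ≤ Φ ω (Qcube r (z i))}
      ≤ ENNReal.ofReal (Real.exp (-(s + (1 - Real.exp s) * lam * (2 * r) ^ d))) ^ n := by
  set a : ℝ := lam * (2 * r) ^ d with ha
  have ha0 : 0 < a := by positivity
  have hQ : ∀ i, ∫⁻ ω, Φ ω (Qcube r (z i)) ∂P = ENNReal.ofReal a := fun i => by
    rw [hint _ (measurableSet_Qcube r (z i)), volume_Qcube r hr, ha,
      ENNReal.ofReal_mul hlam.le]
  have hmeas : Measurable fun ω => ∏ i, Φ ω (Qcube r (z i)) :=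
    Finset.measurable_fun_prod _ fun i _ =>
      (Measure.measurable_coe (measurableSet_Qcube r (z i))).comp hΦmeas
  have hmoment : P {ω | ∀ i, 1 ≤ Φ ω (Qcube r (z i))} ≤ ENNReal.ofReal a ^ n :=
    calc P {ω | ∀ i, 1 ≤ Φ ω (Qcube r (z i))}
        ≤ P {ω | 1 ≤ ∏ i, Φ ω (Qcube r (z i))} :=
          measure_mono fun ω hω => Finset.one_le_prod' fun i _ => hω i
      _ ≤ ∫⁻ ω, ∏ i, Φ ω (Qcube r (z i)) ∂P := by
          simpa using mul_meas_ge_le_lintegral (μ := P) hmeas 1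
      _ ≤ ∏ i, ∫⁻ ω, Φ ω (Qcube r (z i)) ∂P :=
          hsub n _ (fun i => ⟨measurableSet_Qcube r (z i), isBounded_Qcube r (z i)⟩)
            fun i j hij => disjoint_Qcube hr (hlattice i) (hlattice j) (hdistinct.ne hij)
      _ = ENNReal.ofReal a ^ n := by simp [hQ]
  have hexp := min_one_le_exp ha0 hs.le
  rw [mul_assoc]
  rcases min_le_iff.1 hexp with h | h
  · exact prob_le_one.trans (one_le_pow₀ (by simpa using ENNReal.ofReal_le_ofReal h))
  · exact hmoment.trans (by gcongr)
end
end

section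
/- Let Φ be a simple, α-weakly sub-Poisson point process on ℝ^d with Radon mean measure α, and let Π_α be the Poisson point process with the same mean measure α. Then for every k ≥ 1 and all (not necessarily disjoint) bounded Borel sets B_1,…,B_k ⊂ ℝ^d, the moment measures are ordered: E[∏_{i=1}^k Φ(B_i)] ≤ E[∏_{i=1}^k Π_α(B_i)]. -/
open MeasureTheory ENNReal Metric

noncomputable section

/-- The Poisson probability `e^{−t} t^n / n!`. -/
def poissonPMF (t : ℝ≥0∞) (n : ℕ) : ℝ≥0∞ :=
  ENNReal.ofReal (Real.exp (-t.toReal) * t.toReal ^ n / n.factorial)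

/-- `Ψ` is a Poisson point process with intensity measure `m`: the numbers of points
in disjoint bounded Borel sets are independent Poisson random variables. -/
def IsPoissonPP {d : ℕ} {Ω : Type*} [MeasurableSpace Ω] (P : Measure Ω)
    (Ψ : Ω → Measure (EuclideanSpace ℝ (Fin d)))
    (m : Measure (EuclideanSpace ℝ (Fin d))) : Prop :=
  Measurable Ψ ∧
    ∀ (k : ℕ) (B : Fin k → Set (EuclideanSpace ℝ (Fin d))),
      (∀ i, MeasurableSet (B i) ∧ Bornology.IsBounded (B i)) →
      Pairwise (Function.onFun Disjoint B) →
      ∀ n : Fin k → ℕ,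
        P {ω | ∀ i, Ψ ω (B i) = (n i : ℝ≥0∞)} = ∏ i, poissonPMF (m (B i)) (n i)

open Filter Topology Finset in
/-- The truncated means of the Poisson distribution converge to its parameter. -/
lemma tendsto_sum_range_mul_poissonPMF {t : ℝ≥0∞} (ht : t ≠ ∞) :
    Tendsto (fun N => ∑ n ∈ range N, (n : ℝ≥0∞) * poissonPMF t n) atTop (𝓝 t) := by
  lift t to NNReal using ht
  have hexp : HasSum (fun n : ℕ => (t : ℝ) * (Real.exp (-t) * ((t : ℝ) ^ n / n.factorial)))
      (t : ℝ) := by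
    have h := ((NormedSpace.expSeries_div_hasSum_exp (t : ℝ)).mul_left
      (Real.exp (-t))).mul_left (t : ℝ)
    rwa [← Real.exp_eq_exp_ℝ, ← Real.exp_add, neg_add_cancel, Real.exp_zero, mul_one] at h
  have hmean : HasSum (fun n : ℕ => (n : ℝ) * (Real.exp (-t) * (t : ℝ) ^ n / n.factorial))
      (t : ℝ) := by
    rw [← hasSum_nat_add_iff' 1]
    rw [Finset.sum_range_one, Nat.cast_zero, zero_mul, sub_zero]
    refine hexp.congr_fun fun n => ?_
    rw [Nat.factorial_succ]
    push_cast
    field_simp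
    exact pow_succ' _ _
  have h := ENNReal.tendsto_ofReal hmean.tendsto_sum_nat
  rw [ENNReal.ofReal_coe_nnreal] at h
  refine h.congr fun N => ?_
  rw [ENNReal.ofReal_sum_of_nonneg fun n _ => by positivity]
  refine sum_congr rfl fun n _ => ?_
  rw [ENNReal.ofReal_mul (by positivity), ENNReal.ofReal_natCast]
  rfl

open Finset in
/-- If the mixed moments of order one of `ℕ`-valued variables `X j` are at most products of
the `a j`, and all mixed moments of the `Y j` are at least such products, then products of sums
of the `X j` have a smaller expectation than the same products of sums of the `Y j`. -/
lemma lintegral_prod_sum_min_one_le {κ ι Ω Ω' : Type*} [Fintype κ] [DecidableEq κ]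
    [DecidableEq ι]
    [MeasurableSpace Ω] [MeasurableSpace Ω'] {P : Measure Ω} {P' : Measure Ω'}
    {X : ι → Ω → ℝ≥0∞} {Y : ι → Ω' → ℝ≥0∞} {a : ι → ℝ≥0∞}
    (hXm : ∀ j, Measurable (X j)) (hYm : ∀ j, Measurable (Y j))
    (hXnat : ∀ᵐ ω ∂P, ∀ j, ∃ n : ℕ, X j ω = n)
    (hX : ∀ s : Finset ι, ∫⁻ ω, ∏ j ∈ s, X j ω ∂P ≤ ∏ j ∈ s, a j)
    (hY : ∀ c : κ → ι, ∏ j ∈ univ.image c, a j ≤ ∫⁻ ω, ∏ i, Y (c i) ω ∂P')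
    (J : κ → Finset ι) :
    ∫⁻ ω, ∏ i, ∑ j ∈ J i, min (X j ω) 1 ∂P ≤ ∫⁻ ω, ∏ i, ∑ j ∈ J i, Y j ω ∂P' := by
  simp_rw [prod_univ_sum]
  rw [lintegral_finsetSum _ fun c _ =>
      Finset.measurable_prod _ fun i _ => (hXm (c i)).min measurable_const,
    lintegral_finsetSum _ fun c _ => Finset.measurable_prod _ fun i _ => hYm (c i)]
  refine sum_le_sum fun c _ => le_trans ?_ ((hX (univ.image c)).trans (hY c))
  refine lintegral_mono_ae ?_
  filter_upwards [hXnat] with ω hω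
  rw [prod_comp (fun j => min (X j ω) 1) c]
  refine prod_le_prod' fun j hj => ?_
  obtain ⟨i, -, rfl⟩ := mem_image.1 hj
  have hne : #{i' | c i' = c i} ≠ 0 := (card_pos.2 ⟨i, by simp⟩).ne'
  obtain ⟨n, hn⟩ := hω (c i)
  rw [hn]
  rcases n with _ | n
  · simp [hne]
  · simp

open Filter Topology in
/-- Along a refining sequence of finite partitions that separates points, the cells of a finite
integer-valued measure with atoms of mass at most one eventually all have mass at most one. -/
lemma eventually_forall_measure_preimage_inter_le_one {E : Type*} [MeasurableSpace E]
    {κ : ℕ → Type*} [∀ n, MeasurableSpace (κ n)] [∀ n, DiscreteMeasurableSpace (κ n)]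
    {f : ∀ n, E → κ n} (hf : ∀ n, Measurable (f n))
    (hrefine : ∀ ⦃m n⦄, m ≤ n → ∀ x y, f n x = f n y → f m x = f m y)
    (hsep : ∀ x y, (∀ n, f n x = f n y) → x = y)
    {μ : Measure E} {U : Set E} (hU : MeasurableSet U) (hfin : μ U ≠ ∞)
    (hnat : ∀ V ⊆ U, MeasurableSet V → ∃ n : ℕ, μ V = n)
    (hatom : ∀ x, μ {x} ≤ 1) :
    ∀ᶠ n in atTop, ∀ j, μ (f n ⁻¹' {j} ∩ U) ≤ 1 := by
  have hcell : ∀ n j, MeasurableSet (f n ⁻¹' {j} ∩ U) := fun n j =>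
    (hf n (MeasurableSet.of_discrete)).inter hU
  set D : ℕ → Set E := fun n => f n ⁻¹' {j | 1 < μ (f n ⁻¹' {j} ∩ U)} ∩ U
  have hDm : ∀ n, MeasurableSet (D n) := fun n => (hf n (MeasurableSet.of_discrete)).inter hU
  have hanti : ∀ ⦃m n⦄, m ≤ n → ∀ x, f n ⁻¹' {f n x} ∩ U ⊆ f m ⁻¹' {f m x} ∩ U :=
    fun m n hmn x y hy => ⟨hrefine hmn _ _ hy.1, hy.2⟩
  have hDanti : Antitone D := fun m n hmn x hx =>
    ⟨lt_of_lt_of_le hx.1 (measure_mono (hanti hmn x)), hx.2⟩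
  have hDfin : ∀ n, μ (D n) ≠ ∞ := fun n => measure_ne_top_of_subset Set.inter_subset_right hfin
  have hDempty : ⋂ n, D n = ∅ := by
    refine Set.eq_empty_of_forall_notMem fun x hx => ?_
    have hxD : ∀ n, x ∈ D n := Set.mem_iInter.1 hx
    have hlim := tendsto_measure_iInter_atTop (μ := μ) (s := fun n => f n ⁻¹' {f n x} ∩ U)
      (fun n => (hcell n _).nullMeasurableSet) (fun m n hmn => hanti hmn x)
      ⟨0, measure_ne_top_of_subset Set.inter_subset_right hfin⟩
    have hsub : ⋂ n, f n ⁻¹' {f n x} ∩ U ⊆ {x} := fun y hy =>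
      hsep y x fun n => (Set.mem_iInter.1 hy n).1
    have htwo : (2 : ℝ≥0∞) ≤ μ (⋂ n, f n ⁻¹' {f n x} ∩ U) := by
      refine ge_of_tendsto' hlim fun n => ?_
      have hlt : 1 < μ (f n ⁻¹' {f n x} ∩ U) := (hxD n).1
      obtain ⟨m, hm⟩ := hnat _ Set.inter_subset_right (hcell n (f n x))
      rw [Function.comp_apply, hm]
      rw [hm] at hlt
      have : 1 < m := by exact_mod_cast hlt
      exact_mod_cast this
    have := (htwo.trans (measure_mono hsub)).trans (hatom x)
    norm_num at this
  have hlim := tendsto_measure_iInter_atTop (μ := μ) (s := D)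
    (fun n => (hDm n).nullMeasurableSet) hDanti ⟨0, hDfin 0⟩
  rw [hDempty, measure_empty] at hlim
  filter_upwards [hlim.eventually_lt_const one_pos] with n hn j
  by_contra! hj
  refine lt_irrefl (1 : ℝ≥0∞) (hj.trans_le ((measure_mono ?_).trans hn.le))
  rintro x ⟨rfl, hx⟩
  exact ⟨hj, hx⟩

section IsPoissonPP

variable {d : ℕ} {Ω : Type*} [MeasurableSpace Ω] {P : Measure Ω}
  {Ψ : Ω → Measure (EuclideanSpace ℝ (Fin d))} {m : Measure (EuclideanSpace ℝ (Fin d))}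

open Filter Topology Finset in
/-- For a Poisson process, mixed moments of the counts of disjoint sets dominate
the product of the intensities of these sets. -/
lemma IsPoissonPP.prod_le_lintegral_prod_comp_of_surjective {κ : Type*} [Fintype κ]
    (hΨ : IsPoissonPP P Ψ m) {k : ℕ} {B : Fin k → Set (EuclideanSpace ℝ (Fin d))}
    (hB : ∀ i, MeasurableSet (B i) ∧ Bornology.IsBounded (B i))
    (hdisj : Pairwise (Function.onFun Disjoint B)) (hfin : ∀ i, m (B i) ≠ ∞)
    {c : κ → Fin k} (hc : Function.Surjective c) :
    ∏ i, m (B i) ≤ ∫⁻ ω, ∏ j, Ψ ω (B (c j)) ∂P := by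
  have hmeas : ∀ i, Measurable fun ω => Ψ ω (B i) := fun i =>
    (Measure.measurable_coe (hB i).1).comp hΨ.1
  have hlim := ENNReal.tendsto_finsetProd_of_ne_top univ
    (fun i _ => tendsto_sum_range_mul_poissonPMF (hfin i)) (fun i _ => hfin i)
  refine le_of_tendsto' hlim fun N => ?_
  rw [prod_univ_sum]
  set A : (Fin k → ℕ) → Set Ω := fun n => {ω | ∀ i, Ψ ω (B i) = (n i : ℝ≥0∞)} with hA
  have hAm : ∀ n, MeasurableSet (A n) := fun n => by
    simp only [hA, Set.ofPred_forall]
    exact MeasurableSet.iInter fun i => hmeas i (measurableSet_singleton _)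
  have hAdisj : Pairwise (Function.onFun Disjoint A) := fun n n' hne =>
    Set.disjoint_left.2 fun ω hω hω' => hne <| funext fun i => by
      have := (hω i).symm.trans (hω' i)
      exact_mod_cast this
  have hpow : ∀ n : Fin k → ℕ, ∏ i, (n i : ℝ≥0∞) ≤ ∏ j, (n (c j) : ℝ≥0∞) := fun n => by
    classical
    rw [prod_comp (fun i => (n i : ℝ≥0∞)) c, image_univ_of_surjective hc]
    refine prod_le_prod' fun i _ => ?_
    obtain ⟨j, rfl⟩ := hc i
    have hne : #{j' | c j' = c j} ≠ 0 := (card_pos.2 ⟨j, by simp⟩).ne'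
    exact_mod_cast Nat.le_self_pow hne _
  calc ∑ n ∈ Fintype.piFinset fun _ => range N, ∏ i, (n i : ℝ≥0∞) * poissonPMF (m (B i)) (n i)
      ≤ ∑ n ∈ Fintype.piFinset fun _ => range N, ∫⁻ ω in A n, ∏ j, Ψ ω (B (c j)) ∂P := by
        refine sum_le_sum fun n _ => ?_
        rw [prod_mul_distrib, ← hΨ.2 k B hB hdisj n,
          setLIntegral_congr_fun (g := fun _ => ∏ j, (n (c j) : ℝ≥0∞)) (hAm n)
            fun ω hω => prod_congr rfl fun j _ => hω (c j), setLIntegral_const]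
        exact mul_le_mul_left (hpow n) _
    _ = ∫⁻ ω in ⋃ n ∈ Fintype.piFinset fun _ => range N, A n, ∏ j, Ψ ω (B (c j)) ∂P :=
        (lintegral_biUnion_finset (fun n _ n' _ h => hAdisj h) (fun n _ => hAm n) _).symm
    _ ≤ ∫⁻ ω, ∏ j, Ψ ω (B (c j)) ∂P := setLIntegral_le_lintegral _ _

open Finset in
/-- For a Poisson process, mixed moments of the counts of disjoint sets dominate the product of
the intensities of the sets that occur. -/
lemma IsPoissonPP.prod_image_le_lintegral_prod {κ ι : Type*} [Fintype κ] [DecidableEq ι]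
    (hΨ : IsPoissonPP P Ψ m) {C : ι → Set (EuclideanSpace ℝ (Fin d))}
    (hC : ∀ j, MeasurableSet (C j) ∧ Bornology.IsBounded (C j))
    (hdisj : Pairwise (Function.onFun Disjoint C)) (hfin : ∀ j, m (C j) ≠ ∞) (c : κ → ι) :
    ∏ j ∈ univ.image c, m (C j) ≤ ∫⁻ ω, ∏ i, Ψ ω (C (c i)) ∂P := by
  let e := (univ.image c).equivFin
  have h := hΨ.prod_le_lintegral_prod_comp_of_surjective
    (B := fun i => C (e.symm i)) (fun i => hC _)
    (fun i i' hne => hdisj fun h => hne (e.symm.injective (Subtype.ext h))) (fun i => hfin _)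
    (c := fun i => e ⟨c i, mem_image_of_mem c (mem_univ i)⟩) (fun b => by
      obtain ⟨i, -, hi⟩ := mem_image.1 (e.symm b).2
      exact ⟨i, by simp [hi]⟩)
  simp only [Equiv.symm_apply_apply] at h
  rwa [e.symm.prod_comp (fun j => m (C j)), prod_coe_sort _ (fun j => m (C j))] at h

end IsPoissonPP

section Cells

variable {E : Type*} [MeasurableSpace E] [MeasurableSpace.CountablyGenerated E] {k : ℕ}

open Classical in
/-- The label of the cell containing `x` in the partition generated by the first `n` sets of a
countable generating family and by the sets `B i`. -/
def cellLabel (B : Fin k → Set E) (n : ℕ) (x : E) : (Fin n → Bool) × (Fin k → Bool) :=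
  (fun i => MeasurableSpace.mapNatBool E x i, fun i => decide (x ∈ B i))

lemma measurable_cellLabel {B : Fin k → Set E} (hB : ∀ i, MeasurableSet (B i)) (n : ℕ) :
    Measurable (cellLabel B n) := by
  classical
  refine Measurable.prodMk (measurable_pi_lambda _ fun i =>
    (measurable_pi_apply _).comp (MeasurableSpace.measurable_mapNatBool E))
    (measurable_pi_lambda _ fun i => measurable_to_bool ?_)
  simpa [Set.preimage] using hB i

lemma cellLabel_eq_of_le {B : Fin k → Set E} {m n : ℕ} (hmn : m ≤ n) (x y : E)
    (h : cellLabel B n x = cellLabel B n y) : cellLabel B m x = cellLabel B m y := by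
  rw [cellLabel, cellLabel, Prod.mk.injEq] at h ⊢
  exact ⟨funext fun i => congrFun h.1 (i.castLE hmn), h.2⟩

lemma eq_of_forall_cellLabel_eq [MeasurableSpace.SeparatesPoints E] {B : Fin k → Set E} (x y : E)
    (h : ∀ n, cellLabel B n x = cellLabel B n y) : x = y :=
  MeasurableSpace.injective_mapNatBool E <| funext fun i =>
    congrFun (congrArg Prod.fst (h (i + 1))) (Fin.last i)

/-- A set `B i` is the union of the cells whose label says that they lie in `B i`. -/
lemma measure_eq_sum_cellLabel {B : Fin k → Set E} (hB : ∀ i, MeasurableSet (B i)) (n : ℕ)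
    (μ : Measure E) (i : Fin k) :
    μ (B i) = ∑ j : (Fin n → Bool) × (Fin k → Bool) with j.2 i = true,
      μ (cellLabel B n ⁻¹' {j} ∩ ⋃ l, B l) := by
  rw [← measure_biUnion_finset]
  · congr 1
    ext x
    simp only [Set.mem_iUnion, Set.mem_inter_iff, Set.mem_preimage, Set.mem_singleton_iff,
      Finset.mem_filter, Finset.mem_univ, true_and, exists_prop]
    constructor
    · exact fun hx => ⟨_, by simpa [cellLabel] using hx, rfl, i, hx⟩
    · rintro ⟨j, hj, rfl, -⟩
      simpa [cellLabel] using hj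
  · exact fun j _ j' _ hne => ((Set.disjoint_singleton.2 hne).preimage _).mono
      Set.inter_subset_left Set.inter_subset_left
  · exact fun j _ => (measurable_cellLabel hB n (measurableSet_singleton j)).inter
      (MeasurableSet.iUnion hB)

end Cells

/-- if `Φ` is a simple, α-weakly sub-Poisson point process with Radon
mean measure `α`, and `Π_α` is the Poisson point process with the same mean measure,
then all moment measures are ordered, i.e. for all (not necessarily disjoint) bounded
Borel sets `B_1, …, B_k`, `E[∏ Φ(B_i)] ≤ E[∏ Π_α(B_i)]`. -/
theorem moment_measures_le_poisson_of_alphaWeaklySubPoisson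
    {d : ℕ}
    -- the point process `Φ`
    {Ω : Type*} [MeasurableSpace Ω] (P : Measure Ω) [IsProbabilityMeasure P]
    (Φ : Ω → Measure (EuclideanSpace ℝ (Fin d)))
    (hΦmeas : Measurable Φ)
    (hcount : ∀ᵐ ω ∂P, ∀ B : Set (EuclideanSpace ℝ (Fin d)),
      MeasurableSet B → Bornology.IsBounded B → ∃ n : ℕ, Φ ω B = n)
    (hsimple : ∀ᵐ ω ∂P, ∀ x, Φ ω {x} ≤ 1)
    -- `α` is the mean measure of `Φ`, assumed Radon
    (α : Measure (EuclideanSpace ℝ (Fin d)))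
    (hmean : ∀ B : Set (EuclideanSpace ℝ (Fin d)), MeasurableSet B → α B = ∫⁻ ω, Φ ω B ∂P)
    (hRadon : ∀ B : Set (EuclideanSpace ℝ (Fin d)), Bornology.IsBounded B → α B < ∞)
    -- `Φ` is α-weakly sub-Poisson
    (hsub : ∀ (k : ℕ) (B : Fin k → Set (EuclideanSpace ℝ (Fin d))),
      (∀ i, MeasurableSet (B i) ∧ Bornology.IsBounded (B i)) →
      Pairwise (Function.onFun Disjoint B) →
      ∫⁻ ω, ∏ i, Φ ω (B i) ∂P ≤ ∏ i, ∫⁻ ω, Φ ω (B i) ∂P)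
    -- `Π_α`: a Poisson point process with the same mean measure `α`
    {Ω' : Type*} [MeasurableSpace Ω'] (P' : Measure Ω') [IsProbabilityMeasure P']
    (Pois : Ω' → Measure (EuclideanSpace ℝ (Fin d)))
    (hPois : IsPoissonPP P' Pois α) :
    ∀ (k : ℕ) (B : Fin k → Set (EuclideanSpace ℝ (Fin d))),
      (∀ i, MeasurableSet (B i) ∧ Bornology.IsBounded (B i)) →
      ∫⁻ ω, ∏ i, Φ ω (B i) ∂P ≤ ∫⁻ ω, ∏ i, Pois ω (B i) ∂P' := by
  intro k B hB
  set U := ⋃ l, B l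
  have hUm : MeasurableSet U := MeasurableSet.iUnion fun i => (hB i).1
  have hUb : Bornology.IsBounded U := Bornology.isBounded_iUnion.2 fun i => (hB i).2
  have hBm : ∀ i, MeasurableSet (B i) := fun i => (hB i).1
  let C : ∀ n, (Fin n → Bool) × (Fin k → Bool) → Set (EuclideanSpace ℝ (Fin d)) :=
    fun n j => cellLabel B n ⁻¹' {j} ∩ U
  have hC : ∀ n j, MeasurableSet (C n j) ∧ Bornology.IsBounded (C n j) := fun n j =>
    ⟨(measurable_cellLabel hBm n (measurableSet_singleton j)).inter hUm,
      hUb.subset Set.inter_subset_right⟩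
  have hCdisj : ∀ n, Pairwise (Function.onFun Disjoint (C n)) := fun n j j' hne =>
    ((Set.disjoint_singleton.2 hne).preimage _).mono Set.inter_subset_left Set.inter_subset_left
  have hCmeas : ∀ n j, Measurable fun ω => Φ ω (C n j) := fun n j =>
    (Measure.measurable_coe (hC n j).1).comp hΦmeas
  let J : ∀ n, Fin k → Finset ((Fin n → Bool) × (Fin k → Bool)) := fun n i => {j | j.2 i = true}
  have hbound : ∀ n, ∫⁻ ω, ∏ i, ∑ j ∈ J n i, min (Φ ω (C n j)) 1 ∂P ≤
      ∫⁻ ω, ∏ i, Pois ω (B i) ∂P' := fun n => by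
    simp_rw [measure_eq_sum_cellLabel hBm n (Pois _)]
    refine lintegral_prod_sum_min_one_le (X := fun j ω => Φ ω (C n j))
      (Y := fun j ω => Pois ω (C n j)) (a := fun j => α (C n j)) (hCmeas n)
      (fun j => (Measure.measurable_coe (hC n j).1).comp hPois.1) ?_ (fun s => ?_)
      (hPois.prod_image_le_lintegral_prod (hC n) (hCdisj n) fun j => (hRadon _ (hC n j).2).ne)
      (J n)
    · filter_upwards [hcount] with ω hω j using hω _ (hC n j).1 (hC n j).2
    · let e := s.equivFin
      have h := hsub _ (fun i => C n (e.symm i)) (fun i => hC n _)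
        (fun i i' hne => hCdisj n fun h => hne (e.symm.injective (Subtype.ext h)))
      simp_rw [← hmean _ (hC n _).1] at h
      rw [e.symm.prod_comp (fun j => α (C n j)), s.prod_coe_sort (fun j => α (C n j))] at h
      refine le_of_eq_of_le (lintegral_congr fun ω => ?_) h
      rw [e.symm.prod_comp (fun j => Φ ω (C n j)), s.prod_coe_sort (fun j => Φ ω (C n j))]
  have hlim : ∀ᵐ ω ∂P, ∏ i, Φ ω (B i) ≤
      Filter.liminf (fun n => ∏ i, ∑ j ∈ J n i, min (Φ ω (C n j)) 1) Filter.atTop := by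
    filter_upwards [hcount, hsimple] with ω hω hω'
    obtain ⟨N, hN⟩ := hω U hUm hUb
    have hev := eventually_forall_measure_preimage_inter_le_one (measurable_cellLabel hBm)
      (fun m n hmn => cellLabel_eq_of_le hmn) eq_of_forall_cellLabel_eq hUm
      (hN ▸ ENNReal.natCast_ne_top N) (fun V hV hVm => hω V hVm (hUb.subset hV)) hω'
    refine Filter.le_liminf_of_le (by isBoundedDefault) ?_
    filter_upwards [hev] with n hn
    refine le_of_eq (Finset.prod_congr rfl fun i _ => ?_)
    rw [measure_eq_sum_cellLabel hBm n]
    exact Finset.sum_congr rfl fun j _ => (min_eq_left (hn j)).symm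
  calc ∫⁻ ω, ∏ i, Φ ω (B i) ∂P
      ≤ ∫⁻ ω, Filter.liminf (fun n => ∏ i, ∑ j ∈ J n i, min (Φ ω (C n j)) 1) Filter.atTop ∂P :=
        lintegral_mono_ae hlim
    _ ≤ Filter.liminf (fun n => ∫⁻ ω, ∏ i, ∑ j ∈ J n i, min (Φ ω (C n j)) 1 ∂P) Filter.atTop :=
        lintegral_liminf_le fun n => Finset.measurable_prod _ fun i _ =>
          Finset.measurable_sum _ fun j _ => (hCmeas n j).min measurable_const
    _ ≤ ∫⁻ ω, ∏ i, Pois ω (B i) ∂P' :=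
        Filter.liminf_le_of_frequently_le' (Filter.Frequently.of_forall hbound)
end
end

section
/- Fix r > 0 and for R > e define μ(R) = (2πR/r) · log( R / √(log R) ). Then (R² / μ(R)) · ( 1 − √(log R)/R )^{2πR/r} → ∞ as R → ∞. Equivalently, writing K = 2πR/r and p(R,μ) = (1 − e^{−μ/K})^K, one has p(R,μ(R)) · R² / μ(R) → ∞ as R → ∞. -/
open Filter Real

noncomputable section

lemma exp_neg_two_mul_le_one_sub {t : ℝ} (h0 : 0 ≤ t) (h1 : t ≤ 1 / 2) :
    Real.exp (-(2 * t)) ≤ 1 - t := by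
  rw [Real.exp_neg]
  apply inv_le_of_inv_le₀ (by linarith)
  have h2 : (1 - t)⁻¹ ≤ 1 + 2 * t := by
    rw [inv_le_iff_one_le_mul₀ (by linarith)]
    nlinarith
  linarith [Real.add_one_le_exp (2 * t)]

/-- Lower bound for `(R² / (K log(R/s))) (1 - s/R)^K`, where `K = cR` and `s = √(log R)`,
i.e. `R = exp (s²)`. -/
lemma exp_div_sq_le_annular {c s : ℝ} (hc : 0 < c) (hs1 : 1 < s) (hs : 2 * c + 1 ≤ s) :
    c⁻¹ * (Real.exp s / s ^ 2) ≤
      Real.exp (s ^ 2) ^ 2 / (c * Real.exp (s ^ 2) * Real.log (Real.exp (s ^ 2) / s)) *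
        (1 - s / Real.exp (s ^ 2)) ^ (c * Real.exp (s ^ 2)) := by
  have hs0 : 0 < s := by linarith
  have hR : 2 * s ≤ Real.exp (s ^ 2) := by
    nlinarith [Real.add_one_le_exp (s ^ 2), sq_nonneg (s - 1)]
  have hlog : Real.log (Real.exp (s ^ 2) / s) ≤ s ^ 2 := by
    rw [Real.log_div (Real.exp_pos _).ne' hs0.ne', Real.log_exp]
    linarith [Real.log_pos hs1]
  have hlog0 : 0 < Real.log (Real.exp (s ^ 2) / s) :=
    Real.log_pos ((one_lt_div hs0).2 (by linarith))
  have hle : s + 2 * c * s ≤ s ^ 2 := by nlinarith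
  have hexp : Real.exp s ≤ Real.exp (s ^ 2) * Real.exp (-(2 * c * s)) := by
    rw [← Real.exp_add]
    exact Real.exp_le_exp.2 (by linarith)
  generalize Real.exp (s ^ 2) = R at *
  have hR0 : 0 < R := by linarith
  have hpow : Real.exp (-(2 * c * s)) ≤ (1 - s / R) ^ (c * R) := by
    have h := exp_neg_two_mul_le_one_sub (t := s / R) (by positivity)
      (by rw [div_le_iff₀ hR0]; linarith)
    calc Real.exp (-(2 * c * s)) = Real.exp (-(2 * (s / R))) ^ (c * R) := by
          rw [← Real.exp_mul]
          congr 1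
          field_simp
      _ ≤ _ := Real.rpow_le_rpow (Real.exp_pos _).le h (by positivity)
  calc c⁻¹ * (Real.exp s / s ^ 2)
      ≤ c⁻¹ * (R * Real.exp (-(2 * c * s)) / s ^ 2) := by gcongr
    _ = R ^ 2 / (c * R * s ^ 2) * Real.exp (-(2 * c * s)) := by field_simp
    _ ≤ _ := by gcongr

/-- with `K = 2πR/r` and `μ(R) = K · log(R/√(log R))`, both
`(R²/μ(R)) · (1 − √(log R)/R)^K → ∞` and, equivalently,
`p(R, μ(R)) · R² / μ(R) → ∞` as `R → ∞`, where `p(R,μ) = (1 − e^{−μ/K})^K`. -/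
theorem annular_cluster_asymptotics (r : ℝ) (hr : 0 < r) :
    Tendsto (fun R : ℝ =>
        (R ^ 2 / ((2 * π * R / r) * Real.log (R / Real.sqrt (Real.log R)))) *
          (1 - Real.sqrt (Real.log R) / R) ^ (2 * π * R / r))
      atTop atTop ∧
    Tendsto (fun R : ℝ =>
        (1 - Real.exp (-(((2 * π * R / r) * Real.log (R / Real.sqrt (Real.log R)))
              / (2 * π * R / r)))) ^ (2 * π * R / r)
          * R ^ 2 / ((2 * π * R / r) * Real.log (R / Real.sqrt (Real.log R))))
      atTop atTop := by
  have hc : 0 < 2 * π / r := by positivity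
  have hsqrt : Tendsto (fun R : ℝ => Real.sqrt (Real.log R)) atTop atTop :=
    Real.tendsto_sqrt_atTop.comp Real.tendsto_log_atTop
  have first : Tendsto (fun R : ℝ =>
        (R ^ 2 / ((2 * π * R / r) * Real.log (R / Real.sqrt (Real.log R)))) *
          (1 - Real.sqrt (Real.log R) / R) ^ (2 * π * R / r)) atTop atTop := by
    refine tendsto_atTop_mono' _ ?_ (((Real.tendsto_exp_div_pow_atTop 2).comp
      hsqrt).const_mul_atTop (inv_pos.2 hc))
    filter_upwards [hsqrt.eventually_gt_atTop 1,
      hsqrt.eventually_ge_atTop (2 * (2 * π / r) + 1), eventually_gt_atTop 1] with R h1 h2 hR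
    have h := exp_div_sq_le_annular hc h1 h2
    rw [Real.sq_sqrt (Real.log_pos hR).le, Real.exp_log (by linarith)] at h
    have hK : 2 * π * R / r = 2 * π / r * R := by ring
    rw [hK]
    simpa only [Function.comp_apply, Real.sq_sqrt (Real.log_pos hR).le] using h
  refine ⟨first, first.congr' ?_⟩
  filter_upwards [eventually_gt_atTop 1] with R hR
  have hR0 : 0 < R := by linarith
  have hs : 0 < Real.sqrt (Real.log R) := Real.sqrt_pos.2 (Real.log_pos hR)
  rw [mul_div_cancel_left₀ _ (by positivity : 2 * π * R / r ≠ 0), Real.exp_neg,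
    Real.exp_log (by positivity), inv_div]
  ring
end
end
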